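/- Let N_07 be the 4-dimensional ℂ-algebra with basis e_1,e_2,e_3,e_4 and only nonzero basis products e_1e_2 = e_3, e_2e_1 = e_4, e_2e_2 = −e_3. Each of the six bilinear forms Δ₁₁, Δ₂₂, Δ₁₃−Δ₂₃, Δ₂₄, Δ₃₂, Δ₄₁ is a cocycle on N_07, and their cosets modulo B²(N_07,ℂ) form a basis of H²(N_07,ℂ); in particular dim H²(N_07,ℂ) = 6. -/

import Mathlib

/-- The elementary bilinear multiplication on `ℂ^n` sending `(x, y)` to
`(x_i * y_j) • e_k`; the concrete algebra below is a sum of such terms. -/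
noncomputable def T {n : ℕ} (i j k : Fin n) :
    (Fin n → ℂ) →ₗ[ℂ] (Fin n → ℂ) →ₗ[ℂ] (Fin n → ℂ) :=
  LinearMap.mk₂ ℂ (fun x y => (x i * y j) • (Pi.single k 1 : Fin n → ℂ))
    (fun x x' y => by simp [add_mul, add_smul])
    (fun c x y => by simp [smul_eq_mul, smul_smul, mul_assoc])
    (fun x y y' => by simp [mul_add, add_smul])
    (fun c x y => by simp [smul_eq_mul, smul_smul, mul_left_comm])

/-- The bilinear form `Δ_{ij}` on `ℂ^n` (0-indexed): `Δ_{ij}(x,y) = x_i y_j`,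
so that `Δ_{ij}(e_l, e_m) = δ_{il} δ_{jm}`. -/
noncomputable def D {n : ℕ} (i j : Fin n) :
    (Fin n → ℂ) →ₗ[ℂ] (Fin n → ℂ) →ₗ[ℂ] ℂ :=
  LinearMap.mk₂ ℂ (fun x y => x i * y j)
    (fun x x' y => by simp [add_mul])
    (fun c x y => by simp [mul_assoc])
    (fun x y y' => by simp [mul_add])
    (fun c x y => by simp [smul_eq_mul, mul_left_comm])

/-- The cocycle condition: `θ(xy,z) = θ(xz,y)` and `θ(x,yz) = θ(y,xz)`. -/
def IsCocycle {A V : Type*} [AddCommGroup A] [Module ℂ A] [AddCommGroup V] [Module ℂ V]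
    (m : A →ₗ[ℂ] A →ₗ[ℂ] A) (θ : A →ₗ[ℂ] A →ₗ[ℂ] V) : Prop :=
  (∀ x y z : A, θ (m x y) z = θ (m x z) y) ∧ (∀ x y z : A, θ x (m y z) = θ y (m x z))

/-- `Z²(A,ℂ)`: the space of scalar-valued cocycles. -/
noncomputable def Zsub {A : Type*} [AddCommGroup A] [Module ℂ A]
    (m : A →ₗ[ℂ] A →ₗ[ℂ] A) : Submodule ℂ (A →ₗ[ℂ] A →ₗ[ℂ] ℂ) where
  carrier := {θ | IsCocycle m θ}
  add_mem' := by
    rintro θ η ⟨h1, h2⟩ ⟨g1, g2⟩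
    refine ⟨fun x y z => ?_, fun x y z => ?_⟩
    · simp only [LinearMap.add_apply]
      rw [h1 x y z, g1 x y z]
    · simp only [LinearMap.add_apply]
      rw [h2 x y z, g2 x y z]
  zero_mem' := ⟨fun x y z => by simp, fun x y z => by simp⟩
  smul_mem' := by
    rintro c θ ⟨h1, h2⟩
    refine ⟨fun x y z => ?_, fun x y z => ?_⟩
    · simp only [LinearMap.smul_apply]
      rw [h1 x y z]
    · simp only [LinearMap.smul_apply]
      rw [h2 x y z]

/-- The coboundary map `f ↦ δf = ((x,y) ↦ f(xy))`. -/
noncomputable def cobound {A : Type*} [AddCommGroup A] [Module ℂ A]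
    (m : A →ₗ[ℂ] A →ₗ[ℂ] A) : (A →ₗ[ℂ] ℂ) →ₗ[ℂ] (A →ₗ[ℂ] A →ₗ[ℂ] ℂ) where
  toFun f := m.compr₂ f
  map_add' f g := by ext x y; simp [LinearMap.compr₂_apply]
  map_smul' c f := by ext x y; simp [LinearMap.compr₂_apply]

/-- `B²(A,ℂ)`: the space of scalar-valued coboundaries. -/
noncomputable def Bsub {A : Type*} [AddCommGroup A] [Module ℂ A]
    (m : A →ₗ[ℂ] A →ₗ[ℂ] A) : Submodule ℂ (A →ₗ[ℂ] A →ₗ[ℂ] ℂ) :=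
  LinearMap.range (cobound m)

/-- The coset of a bilinear form modulo `B²(A,ℂ)`. -/
noncomputable def cls {A : Type*} [AddCommGroup A] [Module ℂ A]
    (m : A →ₗ[ℂ] A →ₗ[ℂ] A) (θ : A →ₗ[ℂ] A →ₗ[ℂ] ℂ) :
    (A →ₗ[ℂ] A →ₗ[ℂ] ℂ) ⧸ Bsub m :=
  (Bsub m).mkQ θ

/-- `H²(A,ℂ) = Z²(A,ℂ)/B²(A,ℂ)`, realized as the image of the cocycles in the
quotient of the space of all bilinear forms by the coboundaries. -/
noncomputable def H2 {A : Type*} [AddCommGroup A] [Module ℂ A]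
    (m : A →ₗ[ℂ] A →ₗ[ℂ] A) : Submodule ℂ ((A →ₗ[ℂ] A →ₗ[ℂ] ℂ) ⧸ Bsub m) :=
  (Zsub m).map (Bsub m).mkQ

/-- The algebra `N_07` on `ℂ^4`: `e_1 e_2 = e_3`, `e_2 e_1 = e_4`, `e_2 e_2 = -e_3`. -/
noncomputable def mul : (Fin 4 → ℂ) →ₗ[ℂ] (Fin 4 → ℂ) →ₗ[ℂ] (Fin 4 → ℂ) :=
  T 0 1 2 - T 1 1 2 + T 1 0 3

/-- The forms `Δ₁₁, Δ₂₂, Δ₁₃−Δ₂₃, Δ₂₄, Δ₃₂, Δ₄₁` (0-indexed). -/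
noncomputable def forms : Fin 6 → ((Fin 4 → ℂ) →ₗ[ℂ] (Fin 4 → ℂ) →ₗ[ℂ] ℂ) :=
  ![D 0 0, D 1 1, D 0 2 - D 1 2, D 1 3, D 2 1, D 3 0]

theorem mul_eq (x y : Fin 4 → ℂ) :
    mul x y = ![0, 0, x 0 * y 1 - x 1 * y 1, x 1 * y 0] := by
  ext i
  fin_cases i <;> simp [mul, T]

theorem D_apply {n : ℕ} (i j : Fin n) (x y : Fin n → ℂ) : D i j x y = x i * y j := rfl

theorem isCocycle_forms (i : Fin 6) : IsCocycle mul (forms i) := by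
  constructor <;> intro x y z <;> rw [mul_eq, mul_eq] <;> fin_cases i <;>
    simp [forms, D_apply] <;> ring

theorem sum_smul_forms_apply (g : Fin 6 → ℂ) (x y : Fin 4 → ℂ) :
    (∑ i, g i • forms i) x y =
      g 0 * (x 0 * y 0) + g 1 * (x 1 * y 1) + g 2 * (x 0 * y 2 - x 1 * y 2) +
        g 3 * (x 1 * y 3) + g 4 * (x 2 * y 1) + g 5 * (x 3 * y 0) := by
  simp [Fin.sum_univ_six, forms, D_apply]

theorem sum_smul_cls {A : Type*} [AddCommGroup A] [Module ℂ A] (m : A →ₗ[ℂ] A →ₗ[ℂ] A)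
    {ι : Type*} [Fintype ι] (g : ι → ℂ) (θ : ι → A →ₗ[ℂ] A →ₗ[ℂ] ℂ) :
    ∑ i, g i • cls m (θ i) = cls m (∑ i, g i • θ i) := by
  simp only [cls, map_sum, map_smul]

theorem linearIndependent_cls_forms : LinearIndependent ℂ (fun i => cls mul (forms i)) := by
  rw [Fintype.linearIndependent_iff]
  intro g hg
  rw [sum_smul_cls, cls, Submodule.mkQ_apply, Submodule.Quotient.mk_eq_zero] at hg
  obtain ⟨f, hf⟩ := hg
  have key (x y : Fin 4 → ℂ) :
      f ![0, 0, x 0 * y 1 - x 1 * y 1, x 1 * y 0] = (∑ i, g i • forms i) x y := by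
    rw [← hf, ← mul_eq]
    rfl
  simp only [sum_smul_forms_apply] at key
  have f_zero : f ![0, 0, 0, 0] = 0 := by
    rw [show (![0, 0, 0, 0] : Fin 4 → ℂ) = 0 by ext i; fin_cases i <;> rfl, map_zero]
  have f_neg : f ![0, 0, -1, 0] = -f ![0, 0, 1, 0] := by
    rw [← map_neg]
    simp
  have h00 := key ![1, 0, 0, 0] ![1, 0, 0, 0]
  have h01 := key ![1, 0, 0, 0] ![0, 1, 0, 0]
  have h11 := key ![0, 1, 0, 0] ![0, 1, 0, 0]
  have h02 := key ![1, 0, 0, 0] ![0, 0, 1, 0]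
  have h13 := key ![0, 1, 0, 0] ![0, 0, 0, 1]
  have h21 := key ![0, 0, 1, 0] ![0, 1, 0, 0]
  have h30 := key ![0, 0, 0, 1] ![1, 0, 0, 0]
  simp [f_zero, f_neg] at h00 h01 h11 h02 h13 h21 h30
  rw [h01, neg_zero] at h11
  intro i
  fin_cases i
  exacts [h00.symm, h11.symm, h02.symm, h13.symm, h21.symm, h30.symm]

theorem bilin_apply_eq_sum (θ : (Fin 4 → ℂ) →ₗ[ℂ] (Fin 4 → ℂ) →ₗ[ℂ] ℂ) (x y : Fin 4 → ℂ) :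
    θ x y = ∑ i, ∑ j, x i * y j * θ (Pi.single i 1) (Pi.single j 1) := by
  conv_lhs => rw [pi_eq_sum_univ' x, pi_eq_sum_univ' y]
  simp only [map_sum, map_smul, LinearMap.sum_apply, LinearMap.smul_apply, smul_eq_mul,
    Finset.mul_sum, mul_assoc]
  rw [Finset.sum_comm]
  simp only [mul_left_comm]

theorem mul_single (i j : Fin 4) :
    mul (Pi.single i 1) (Pi.single j 1) =
      if i = 0 ∧ j = 1 then Pi.single 2 1
      else if i = 1 ∧ j = 1 then -Pi.single 2 1
      else if i = 1 ∧ j = 0 then Pi.single 3 1 else 0 := by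
  rw [mul_eq]
  ext k
  fin_cases i <;> fin_cases j <;> fin_cases k <;> simp

theorem IsCocycle.eq_sum_add_cobound {θ : (Fin 4 → ℂ) →ₗ[ℂ] (Fin 4 → ℂ) →ₗ[ℂ] ℂ}
    (h : IsCocycle mul θ) :
    ∃ (g : Fin 6 → ℂ) (f : (Fin 4 → ℂ) →ₗ[ℂ] ℂ),
      θ = ∑ i, g i • forms i + cobound mul f := by
  let e (i j : Fin 4) : ℂ := θ (Pi.single i 1) (Pi.single j 1)
  refine ⟨![e 0 0, e 1 1 + e 0 1, e 0 2, e 1 3, e 2 1, e 3 0],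
    e 0 1 • LinearMap.proj 2 + e 1 0 • LinearMap.proj 3, ?_⟩
  have hl (i j k : Fin 4) := h.1 (Pi.single i 1) (Pi.single j 1) (Pi.single k 1)
  have hr (i j k : Fin 4) := h.2 (Pi.single i 1) (Pi.single j 1) (Pi.single k 1)
  simp only [mul_single] at hl hr
  have e20 : e 2 0 = 0 := by simpa using hl 0 1 0
  have e22 : e 2 2 = 0 := by simpa using hl 0 1 2
  have e23 : e 2 3 = 0 := by simpa using hl 0 1 3
  have e31 : e 3 1 = 0 := by
    have : e 3 1 = -e 2 0 := by simpa using hl 1 0 1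
    rw [this, e20, neg_zero]
  have e32 : e 3 2 = 0 := by simpa using hl 1 0 2
  have e33 : e 3 3 = 0 := by simpa using hl 1 0 3
  have e03 : e 0 3 = 0 := by simpa using hr 0 1 0
  have e12 : e 1 2 = -e 0 2 := by simpa using (hr 0 1 1).symm
  refine LinearMap.ext₂ fun x y => ?_
  have hc (f : (Fin 4 → ℂ) →ₗ[ℂ] ℂ) : cobound mul f x y = f (mul x y) := rfl
  rw [LinearMap.add_apply, LinearMap.add_apply, sum_smul_forms_apply, hc, mul_eq,
    bilin_apply_eq_sum]
  change ∑ i, ∑ j, x i * y j * e i j = _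
  simp [Fin.sum_univ_four, e20, e22, e23, e31, e32, e33, e03, e12]
  ring

theorem span_cls_forms :
    Submodule.span ℂ (Set.range fun i => cls mul (forms i)) = H2 mul := by
  apply le_antisymm
  · rw [Submodule.span_le]
    rintro _ ⟨i, rfl⟩
    exact Submodule.mem_map_of_mem (isCocycle_forms i)
  · rintro _ ⟨θ, hθ, rfl⟩
    obtain ⟨g, f, rfl⟩ := IsCocycle.eq_sum_add_cobound hθ
    have hf : (Bsub mul).mkQ (cobound mul f) = 0 := by
      rw [Submodule.mkQ_apply, Submodule.Quotient.mk_eq_zero]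
      exact ⟨f, rfl⟩
    rw [map_add, hf, add_zero]
    change cls mul _ ∈ _
    rw [← sum_smul_cls]
    exact Submodule.sum_mem _ fun i _ =>
      Submodule.smul_mem _ _ (Submodule.subset_span ⟨i, rfl⟩)

/-- The listed forms are cocycles, their cosets modulo `B²` form a basis of `H²`,
and in particular `dim H² = 6`. -/
theorem secondCohomology_N07 :
    (∀ i, IsCocycle mul (forms i)) ∧
    LinearIndependent ℂ (fun i => cls mul (forms i)) ∧
    Submodule.span ℂ (Set.range fun i => cls mul (forms i)) = H2 mul ∧
    Module.finrank ℂ (H2 mul) = 6 := by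
  refine ⟨isCocycle_forms, linearIndependent_cls_forms, span_cls_forms, ?_⟩
  rw [← span_cls_forms, finrank_span_eq_card linearIndependent_cls_forms, Fintype.card_fin]
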